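/- arXiv:2005.08068 — 2 statements merged into one kernel-verified Lean document; each statement's English description precedes it below -/
import Mathlib

section
/- Let S be a nonempty finite type, let P, Q : S → S → ℝ be row-stochastic (entries nonnegative, rows summing to 1), let μ : S → ℝ be a probability vector, and let γ ∈ [0,1). Define the discounted state marginal ρ_P(s') = (1 − γ) · ∑_{t=0}^{∞} γ^t · (μP^t)(s') (the series converges since |(μP^t)(s')| ≤ 1), and ρ_Q analogously. Then ∑_{s'} |ρ_P(s') − ρ_Q(s')| ≤ (γ/(1 − γ)) · max_{s} ∑_{s'} |P s s' − Q s s'|. -/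
open Finset

theorem sum_abs_vecMul_le {S : Type*} [Fintype S] (A : Matrix S S ℝ) (c : ℝ)
    (hA : ∀ s, ∑ s', |A s s'| ≤ c) (v : S → ℝ) :
    ∑ s', |Matrix.vecMul v A s'| ≤ (∑ s, |v s|) * c := by
  calc ∑ s', |Matrix.vecMul v A s'| ≤ ∑ s', ∑ s, |v s| * |A s s'| := by
        refine sum_le_sum fun s' _ => ?_
        simp only [Matrix.vecMul, dotProduct, ← abs_mul]
        exact abs_sum_le_sum_abs _ _
    _ = ∑ s, |v s| * ∑ s', |A s s'| := by
        rw [sum_comm]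
        simp only [mul_sum]
    _ ≤ (∑ s, |v s|) * c := by
        rw [sum_mul]
        exact sum_le_sum fun s _ => mul_le_mul_of_nonneg_left (hA s) (abs_nonneg _)

theorem sum_abs_vecMul_pow_le {S : Type*} [Fintype S] [DecidableEq S] (A : Matrix S S ℝ)
    (hA : ∀ s, ∑ s', |A s s'| ≤ 1) (v : S → ℝ) (t : ℕ) :
    ∑ s', |Matrix.vecMul v (A ^ t) s'| ≤ ∑ s, |v s| := by
  induction t with
  | zero => simp
  | succ t ih =>
    rw [pow_succ, ← Matrix.vecMul_vecMul]
    simpa using (sum_abs_vecMul_le A 1 hA (Matrix.vecMul v (A ^ t))).trans (by simpa using ih)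

theorem sum_abs_vecMul_pow_sub_le {S : Type*} [Fintype S] [DecidableEq S] (A B : Matrix S S ℝ)
    (hA : ∀ s, ∑ s', |A s s'| ≤ 1) (hB : ∀ s, ∑ s', |B s s'| ≤ 1)
    (M : ℝ) (hM : ∀ s, ∑ s', |A s s' - B s s'| ≤ M) (hM0 : 0 ≤ M)
    (v : S → ℝ) (hv : ∑ s, |v s| ≤ 1) (t : ℕ) :
    ∑ s', |Matrix.vecMul v (A ^ t) s' - Matrix.vecMul v (B ^ t) s'| ≤ t * M := by
  induction t with
  | zero => simp
  | succ t ih =>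
    have hdecomp : Matrix.vecMul v (A ^ (t + 1)) - Matrix.vecMul v (B ^ (t + 1)) =
        Matrix.vecMul (Matrix.vecMul v (A ^ t) - Matrix.vecMul v (B ^ t)) A +
          Matrix.vecMul (Matrix.vecMul v (B ^ t)) (A - B) := by
      rw [pow_succ, pow_succ, ← Matrix.vecMul_vecMul, ← Matrix.vecMul_vecMul,
        Matrix.sub_vecMul, Matrix.vecMul_sub]
      abel
    have h₁ := sum_abs_vecMul_le A 1 hA (Matrix.vecMul v (A ^ t) - Matrix.vecMul v (B ^ t))
    have h₂ := sum_abs_vecMul_le (A - B) M hM (Matrix.vecMul v (B ^ t))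
    have h₃ := mul_le_mul_of_nonneg_right ((sum_abs_vecMul_pow_le B hB v t).trans hv) hM0
    calc ∑ s', |Matrix.vecMul v (A ^ (t + 1)) s' - Matrix.vecMul v (B ^ (t + 1)) s'|
        ≤ ∑ s', (|Matrix.vecMul (Matrix.vecMul v (A ^ t) - Matrix.vecMul v (B ^ t)) A s'| +
            |Matrix.vecMul (Matrix.vecMul v (B ^ t)) (A - B) s'|) := by
          refine sum_le_sum fun s' _ => ?_
          rw [← Pi.sub_apply, hdecomp]
          exact abs_add_le _ _
      _ ≤ (t + 1 : ℕ) * M := by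
          rw [sum_add_distrib]
          simp only [Pi.sub_apply] at h₁
          push_cast
          linarith

theorem summable_geometric_mul_vecMul_pow {S : Type*} [Fintype S] [DecidableEq S]
    (A : Matrix S S ℝ) (hA : ∀ s, ∑ s', |A s s'| ≤ 1) (v : S → ℝ)
    {γ : ℝ} (hγ₀ : 0 ≤ γ) (hγ₁ : γ < 1) (s' : S) :
    Summable fun t : ℕ => γ ^ t * Matrix.vecMul v (A ^ t) s' := by
  refine Summable.of_norm_bounded
    ((summable_geometric_of_lt_one hγ₀ hγ₁).mul_right (∑ s, |v s|)) fun t => ?_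
  rw [Real.norm_eq_abs, abs_mul, abs_of_nonneg (pow_nonneg hγ₀ t)]
  refine mul_le_mul_of_nonneg_left ?_ (pow_nonneg hγ₀ t)
  exact (single_le_sum (f := fun s' => |Matrix.vecMul v (A ^ t) s'|)
    (fun _ _ => abs_nonneg _) (mem_univ s')).trans (sum_abs_vecMul_pow_le A hA v t)

theorem sum_abs_discounted_sub_le {S : Type*} [Fintype S] (a b : ℕ → S → ℝ)
    {γ M : ℝ} (hγ₀ : 0 ≤ γ) (hγ₁ : γ < 1)
    (ha : ∀ s, Summable fun t => γ ^ t * a t s) (hb : ∀ s, Summable fun t => γ ^ t * b t s)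
    (hab : ∀ t : ℕ, ∑ s, |a t s - b t s| ≤ t * M) :
    ∑ s, |((1 - γ) * ∑' t, γ ^ t * a t s) - (1 - γ) * ∑' t, γ ^ t * b t s| ≤
      γ / (1 - γ) * M := by
  have hγ' : 0 < 1 - γ := sub_pos.2 hγ₁
  have hsub : ∀ s, Summable fun t => |γ ^ t * a t s - γ ^ t * b t s| :=
    fun s => ((ha s).sub (hb s)).abs
  have hγn : ‖γ‖ < 1 := by rwa [Real.norm_eq_abs, abs_of_nonneg hγ₀]
  have hgeom : HasSum (fun t : ℕ => (t * γ ^ t) * M) (γ / (1 - γ) ^ 2 * M) :=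
    (hasSum_coe_mul_geometric_of_norm_lt_one hγn).mul_right M
  calc ∑ s, |((1 - γ) * ∑' t, γ ^ t * a t s) - (1 - γ) * ∑' t, γ ^ t * b t s|
      ≤ ∑ s, (1 - γ) * ∑' t, |γ ^ t * a t s - γ ^ t * b t s| := by
        refine sum_le_sum fun s _ => ?_
        rw [← mul_sub, ← (ha s).tsum_sub (hb s), abs_mul, abs_of_pos hγ']
        have h := norm_tsum_le_tsum_norm (f := fun t => γ ^ t * a t s - γ ^ t * b t s)
          (by simpa only [Real.norm_eq_abs] using hsub s)
        simp only [Real.norm_eq_abs] at h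
        exact mul_le_mul_of_nonneg_left h hγ'.le
    _ = (1 - γ) * ∑' t, ∑ s, |γ ^ t * a t s - γ ^ t * b t s| := by
        rw [← mul_sum, Summable.tsum_finsetSum fun s _ => hsub s]
    _ ≤ (1 - γ) * (γ / (1 - γ) ^ 2 * M) := by
        refine mul_le_mul_of_nonneg_left ?_ hγ'.le
        rw [← hgeom.tsum_eq]
        refine (summable_sum fun s _ => hsub s).tsum_le_tsum (fun t => ?_) hgeom.summable
        simp only [← mul_sub, abs_mul, abs_of_nonneg (pow_nonneg hγ₀ t), ← mul_sum]
        rw [mul_comm (t : ℝ), mul_assoc]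
        exact mul_le_mul_of_nonneg_left (hab t) (pow_nonneg hγ₀ t)
    _ = γ / (1 - γ) * M := by
        field_simp

theorem stmt_17
    {S : Type*} [Fintype S] [DecidableEq S] [Nonempty S]
    (P Q : Matrix S S ℝ)
    (hPnn : ∀ s s', 0 ≤ P s s') (hProw : ∀ s, ∑ s', P s s' = 1)
    (hQnn : ∀ s s', 0 ≤ Q s s') (hQrow : ∀ s, ∑ s', Q s s' = 1)
    (μ : S → ℝ) (hμnn : ∀ s, 0 ≤ μ s) (hμsum : ∑ s, μ s = 1)
    (γ : ℝ) (hγ : γ ∈ Set.Ico (0 : ℝ) 1) :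
    ∑ s', |((1 - γ) * ∑' t : ℕ, γ ^ t * Matrix.vecMul μ (P ^ t) s') -
        (1 - γ) * ∑' t : ℕ, γ ^ t * Matrix.vecMul μ (Q ^ t) s'| ≤
      (γ / (1 - γ)) * (univ.sup' univ_nonempty fun s => ∑ s', |P s s' - Q s s'|) := by
  obtain ⟨hγ₀, hγ₁⟩ := hγ
  have hM : ∀ s, ∑ s', |P s s' - Q s s'| ≤
      univ.sup' univ_nonempty fun s => ∑ s', |P s s' - Q s s'| := fun s =>
    le_sup' (fun s => ∑ s', |P s s' - Q s s'|) (mem_univ s)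
  have hM0 := (sum_nonneg fun _ _ => abs_nonneg _).trans (hM (Classical.arbitrary S))
  have hP : ∀ s, ∑ s', |P s s'| ≤ 1 := fun s => by simp [abs_of_nonneg (hPnn s _), hProw]
  have hQ : ∀ s, ∑ s', |Q s s'| ≤ 1 := fun s => by simp [abs_of_nonneg (hQnn s _), hQrow]
  have hμ : ∑ s, |μ s| ≤ 1 := by simp [abs_of_nonneg (hμnn _), hμsum]
  exact sum_abs_discounted_sub_le (fun t => Matrix.vecMul μ (P ^ t))
    (fun t => Matrix.vecMul μ (Q ^ t)) hγ₀ hγ₁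
    (summable_geometric_mul_vecMul_pow P hP μ hγ₀ hγ₁)
    (summable_geometric_mul_vecMul_pow Q hQ μ hγ₀ hγ₁)
    (sum_abs_vecMul_pow_sub_le P Q hP hQ _ hM hM0 μ hμ)
end

section
/- Let S and A be nonempty finite types, let γ ∈ [0,1), let T : S → A → S → ℝ be a transition kernel with each T s a a probability vector on S, let r : S → A → ℝ be a reward function with |r s a| ≤ r_max for all s, a, let μ : S → ℝ be a probability vector, and let π, π̂ : S → A → ℝ be policies with each π s and π̂ s a probability vector on A. Define the induced transition matrix (P_π) s s' = ∑_a π s a · T s a s', the induced reward vector (r_π) s = ∑_a π s a · r s a, and the expected discounted return J(π) = ∑_{t=0}^{∞} γ^t · ∑_{s} (μ P_π^t)(s) · r_π(s) (the series converges since the summands are bounded by γ^t r_max). Then |J(π) − J(π̂)| ≤ (r_max/(1 − γ)²) · max_{s} ∑_{a} |π s a − π̂ s a|. -/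
open Finset

open Matrix in
theorem sum_abs_vecMul_le_s19 {m n : Type*} [Fintype m] [Fintype n] (v : m → ℝ) (M : Matrix m n ℝ)
    {c : ℝ} (hM : ∀ i, ∑ j, |M i j| ≤ c) : ∑ j, |(v ᵥ* M) j| ≤ c * ∑ i, |v i| :=
  calc ∑ j, |(v ᵥ* M) j| ≤ ∑ j, ∑ i, |v i| * |M i j| := by
        refine sum_le_sum fun j _ => (abs_sum_le_sum_abs _ _).trans_eq ?_
        simp only [abs_mul]
    _ = ∑ i, |v i| * ∑ j, |M i j| := by
        rw [sum_comm]
        simp only [mul_sum]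
    _ ≤ ∑ i, |v i| * c := by gcongr with i; exact hM i
    _ = c * ∑ i, |v i| := by rw [← sum_mul, mul_comm]

theorem abs_sum_mul_le {m : Type*} [Fintype m] (v x : m → ℝ) {c : ℝ} (hx : ∀ i, |x i| ≤ c) :
    |∑ i, v i * x i| ≤ c * ∑ i, |v i| := by
  refine (abs_sum_le_sum_abs _ _).trans ?_
  rw [mul_comm, sum_mul]
  refine sum_le_sum fun i _ => ?_
  rw [abs_mul]
  gcongr
  exact hx i

open Matrix in
theorem sum_abs_vecMul_pow_le_s19 {m : Type*} [Fintype m] [DecidableEq m] (v : m → ℝ)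
    {M : Matrix m m ℝ} (hM : ∀ i, ∑ j, |M i j| ≤ 1) (t : ℕ) :
    ∑ j, |(v ᵥ* M ^ t) j| ≤ ∑ i, |v i| := by
  induction t with
  | zero => simp
  | succ t ih =>
    rw [pow_succ, ← vecMul_vecMul]
    exact (sum_abs_vecMul_le_s19 _ M hM).trans (by rwa [one_mul])

open Matrix in
theorem sum_abs_vecMul_pow_sub_le_s19 {m : Type*} [Fintype m] [DecidableEq m] (v : m → ℝ)
    {M N : Matrix m m ℝ} (hM : ∀ i, ∑ j, |M i j| ≤ 1) (hN : ∀ i, ∑ j, |N i j| ≤ 1)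
    {d : ℝ} (hd : 0 ≤ d) (hMN : ∀ i, ∑ j, |(M - N) i j| ≤ d) (t : ℕ) :
    ∑ j, |(v ᵥ* M ^ t - v ᵥ* N ^ t) j| ≤ t * (d * ∑ i, |v i|) := by
  induction t with
  | zero => simp
  | succ t ih =>
    have key : v ᵥ* M ^ (t + 1) - v ᵥ* N ^ (t + 1) =
        (v ᵥ* M ^ t - v ᵥ* N ^ t) ᵥ* M + (v ᵥ* N ^ t) ᵥ* (M - N) := by
      rw [sub_vecMul, vecMul_sub, pow_succ, pow_succ, ← vecMul_vecMul, ← vecMul_vecMul]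
      abel
    have h₁ := sum_abs_vecMul_le_s19 (v ᵥ* M ^ t - v ᵥ* N ^ t) M hM
    have h₂ := (sum_abs_vecMul_le_s19 (v ᵥ* N ^ t) (M - N) hMN).trans
      (mul_le_mul_of_nonneg_left (sum_abs_vecMul_pow_le_s19 v hN t) hd)
    rw [key]
    calc _ ≤ ∑ j, (|((v ᵥ* M ^ t - v ᵥ* N ^ t) ᵥ* M) j| + |((v ᵥ* N ^ t) ᵥ* (M - N)) j|) :=
          sum_le_sum fun j _ => abs_add_le _ _
      _ ≤ _ := by
          rw [sum_add_distrib]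
          push_cast
          linarith

theorem stmt_19
    {S A : Type*} [Fintype S] [DecidableEq S] [Nonempty S] [Fintype A] [Nonempty A]
    (γ : ℝ) (hγ : γ ∈ Set.Ico (0 : ℝ) 1)
    (T : S → A → S → ℝ)
    (hTnn : ∀ s a s', 0 ≤ T s a s') (hTsum : ∀ s a, ∑ s', T s a s' = 1)
    (r : S → A → ℝ) (rmax : ℝ) (hr : ∀ s a, |r s a| ≤ rmax)
    (μ : S → ℝ) (hμnn : ∀ s, 0 ≤ μ s) (hμsum : ∑ s, μ s = 1)
    (π πhat : S → A → ℝ)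
    (hπnn : ∀ s a, 0 ≤ π s a) (hπsum : ∀ s, ∑ a, π s a = 1)
    (hπhatnn : ∀ s a, 0 ≤ πhat s a) (hπhatsum : ∀ s, ∑ a, πhat s a = 1) :
    let Pmat : (S → A → ℝ) → Matrix S S ℝ := fun p s s' => ∑ a, p s a * T s a s'
    let rvec : (S → A → ℝ) → S → ℝ := fun p s => ∑ a, p s a * r s a
    let J : (S → A → ℝ) → ℝ := fun p =>
      ∑' t : ℕ, γ ^ t * ∑ s, Matrix.vecMul μ (Pmat p ^ t) s * rvec p s
    |J π - J πhat| ≤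
      (rmax / (1 - γ) ^ 2) *
        univ.sup' univ_nonempty (fun s => ∑ a, |π s a - πhat s a|) := by
  intro Pmat rvec J
  obtain ⟨hγ0, hγ1⟩ := hγ
  set D := univ.sup' univ_nonempty (fun s => ∑ a, |π s a - πhat s a|)
  have hDs : ∀ s, ∑ a, |(π s - πhat s) a| ≤ D := fun s =>
    le_sup' (fun s => ∑ a, |π s a - πhat s a|) (mem_univ s)
  have hD0 : 0 ≤ D :=
    (sum_nonneg fun a _ => abs_nonneg _).trans (hDs (Classical.arbitrary S))
  have hrmax : 0 ≤ rmax :=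
    (abs_nonneg _).trans (hr (Classical.arbitrary S) (Classical.arbitrary A))
  have hμ : ∑ s, |μ s| = 1 := by simp only [abs_of_nonneg (hμnn _), hμsum]
  have hT : ∀ s a, ∑ s', |T s a s'| ≤ 1 := fun s a => by
    simp only [abs_of_nonneg (hTnn _ _ _), hTsum, le_refl]
  have hPabs : ∀ (p : S → A → ℝ) s, ∑ s', |Pmat p s s'| ≤ ∑ a, |p s a| := fun p s =>
    (sum_abs_vecMul_le_s19 (p s) (T s) (hT s)).trans_eq (one_mul _)
  have hpol : ∀ p : S → A → ℝ, (∀ s a, 0 ≤ p s a) → (∀ s, ∑ a, p s a = 1) →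
      ∀ s, ∑ a, |p s a| = 1 := fun p h0 h1 s => by
    simp only [abs_of_nonneg (h0 _ _), h1]
  have hπ := hpol π hπnn hπsum
  have hπhat := hpol πhat hπhatnn hπhatsum
  have hP : ∀ p : S → A → ℝ, (∀ s, ∑ a, |p s a| = 1) → ∀ s, ∑ s', |Pmat p s s'| ≤ 1 :=
    fun p hp s => (hPabs p s).trans_eq (hp s)
  have hPsub : ∀ s, ∑ s', |(Pmat π - Pmat πhat) s s'| ≤ D := fun s => by
    have h : Pmat π - Pmat πhat = Pmat (π - πhat) := by
      ext s s'
      rw [Matrix.sub_apply]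
      simp only [Pmat, Pi.sub_apply, sub_mul, sum_sub_distrib]
    rw [h]
    exact (hPabs _ s).trans (hDs s)
  have hrvec : ∀ p : S → A → ℝ, (∀ s, ∑ a, |p s a| = 1) → ∀ s, |rvec p s| ≤ rmax :=
    fun p hp s => (abs_sum_mul_le (p s) (r s) (hr s)).trans_eq (by rw [hp, mul_one])
  have hrsub : ∀ s, |(rvec π - rvec πhat) s| ≤ rmax * D := fun s => by
    have h : (rvec π - rvec πhat) s = ∑ a, (π s - πhat s) a * r s a := by
      simp [rvec, sub_mul, sum_sub_distrib]
    rw [h]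
    exact (abs_sum_mul_le _ (r s) (hr s)).trans (mul_le_mul_of_nonneg_left (hDs s) hrmax)
  have hsummable : ∀ p : S → A → ℝ, (∀ s, ∑ a, |p s a| = 1) →
      Summable fun t : ℕ => γ ^ t * ∑ s, Matrix.vecMul μ (Pmat p ^ t) s * rvec p s := by
    intro p hp
    refine Summable.of_norm_bounded ((summable_geometric_of_lt_one hγ0 hγ1).mul_right rmax)
      fun t => ?_
    rw [Real.norm_eq_abs, abs_mul, abs_of_nonneg (pow_nonneg hγ0 t)]
    gcongr
    refine (abs_sum_mul_le _ _ (hrvec p hp)).trans ?_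
    have := sum_abs_vecMul_pow_le_s19 μ (hP p hp) t
    exact mul_le_of_le_one_right hrmax (this.trans_eq hμ)
  have hgeom : HasSum (fun t : ℕ => γ ^ t * ((t + 1) * (rmax * D)))
      (rmax / (1 - γ) ^ 2 * D) := by
    have h := (hasSum_choose_mul_geometric_of_norm_lt_one 1
      (by rwa [Real.norm_eq_abs, abs_of_nonneg hγ0] : ‖γ‖ < 1)).mul_right (rmax * D)
    have hval : rmax / (1 - γ) ^ 2 * D = 1 / (1 - γ) ^ (1 + 1) * (rmax * D) := by ring
    have hterm : (fun t : ℕ => γ ^ t * ((t + 1) * (rmax * D))) =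
        fun t : ℕ => ((t + 1).choose 1 : ℝ) * γ ^ t * (rmax * D) := by
      ext t
      rw [Nat.choose_one_right]
      push_cast
      ring
    rwa [hval, hterm]
  have hJ := ((hsummable π hπ).hasSum.sub (hsummable πhat hπhat).hasSum)
  change |(∑' _, _) - ∑' _, _| ≤ _
  rw [← hJ.tsum_eq, ← Real.norm_eq_abs]
  refine tsum_of_norm_bounded hgeom fun t => ?_
  rw [← mul_sub, Real.norm_eq_abs, abs_mul, abs_of_nonneg (pow_nonneg hγ0 t)]
  gcongr
  set v := Matrix.vecMul μ (Pmat π ^ t)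
  set w := Matrix.vecMul μ (Pmat πhat ^ t)
  have hsplit : ∑ s, v s * rvec π s - ∑ s, w s * rvec πhat s =
      ∑ s, (v - w) s * rvec π s + ∑ s, w s * (rvec π - rvec πhat) s := by
    rw [← sum_sub_distrib, ← sum_add_distrib]
    refine sum_congr rfl fun s _ => ?_
    simp only [Pi.sub_apply]
    ring
  have h₁ : |∑ s, (v - w) s * rvec π s| ≤ rmax * (t * D) := by
    refine (abs_sum_mul_le _ _ (hrvec π hπ)).trans (mul_le_mul_of_nonneg_left ?_ hrmax)
    simpa only [hμ, mul_one] using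
      sum_abs_vecMul_pow_sub_le_s19 μ (hP π hπ) (hP πhat hπhat) hD0 hPsub t
  have h₂ : |∑ s, w s * (rvec π - rvec πhat) s| ≤ rmax * D :=
    (abs_sum_mul_le _ _ hrsub).trans (mul_le_of_le_one_right (mul_nonneg hrmax hD0)
      ((sum_abs_vecMul_pow_le_s19 μ (hP πhat hπhat) t).trans_eq hμ))
  rw [hsplit]
  refine (abs_add_le _ _).trans ?_
  linarith
end
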